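/- Let m ≥ 1 and let (a, d) = ((a_0,…,a_{m-1}), d) be a minimal norm pair of length m. Then: (1) if 0 ≤ i < j < m and a_i ≠ -∞ and a_j ≠ -∞, then a_i < a_j; (2) if p = 2, m ≥ 2, and d ∉ U_2, then a_i ≠ 0 for every 1 ≤ i < m. -/

import Mathlib

/-!
Common setup.  Throughout, `K/F` is a cyclic Galois extension of degree `p^n`
with Galois group `G = Gal(K/F)` generated by `σ`.  For `0 ≤ i ≤ n`, `K_i`
denotes the intermediate field of degree `p^i` over `F`, realized here via its
unit group `KiU p σ i` (the units of `K` fixed by `σ^{p^i}`), and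
`G_i = Gal(K_i/F)`.  For `m ≥ 1`, `R_m = ℤ/p^m` and `J_m = K^×/K^{×p^m}`.
-/

namespace MSS

variable {F K : Type*} [Field F] [Field K] [Algebra F K]

/-- Action of a field automorphism on the unit group. -/
def umap (σ : K ≃ₐ[F] K) : Kˣ →* Kˣ := Units.map (σ : K →* K)

/-- The norm from `K_j` to `F`, computed in `K` as the product of conjugates
`∏_{k < p^j} σ^k(γ)` (valid for `γ ∈ K_j`). -/
noncomputable def normHom (p : ℕ) (σ : K ≃ₐ[F] K) (j : ℕ) : Kˣ →* Kˣ :=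
  ∏ k ∈ Finset.range (p ^ j), umap (σ ^ k)

/-- The unit group of the intermediate field `K_i`: the units fixed by `σ^{p^i}`. -/
def KiU (p : ℕ) (σ : K ≃ₐ[F] K) (i : ℕ) : Subgroup Kˣ :=
  (umap (σ ^ p ^ i) / MonoidHom.id Kˣ).ker

/-- Membership in `K_a^×` for a level `a ∈ {-∞, 0, 1, …}`; level `-∞` means
the trivial group `{1}`. -/
def levelMem (p : ℕ) (σ : K ≃ₐ[F] K) (a : WithBot ℕ) (γ : Kˣ) : Prop :=
  WithBot.recBotCoe (γ = 1) (fun i => γ ∈ KiU p σ i) a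

/-- `(α, δ)` represents the pair `(a, d)`:  `σ(α)·α^{-d} = ∏_{i=0}^m δ_i^{p^i}` with
`δ_i ∈ K_{a_i}^×` for `i < m`, and
`ξ_p = N_{K/F}(α)^{(d-1)/p} · N_{K_{n-1}/F}(δ_0) · ∏_{i=1}^m N_{K/F}(δ_i)^{p^{i-1}}`. -/
noncomputable def Represents (p n : ℕ) (σ : K ≃ₐ[F] K) (ξ : Kˣ) {m : ℕ}
    (a : Fin m → WithBot ℕ) (d : ℤ) (α : Kˣ) (δ : ℕ → Kˣ) : Prop :=
  (∀ i : Fin m, levelMem p σ (a i) (δ i)) ∧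
  umap σ α = α ^ d * ∏ i ∈ Finset.range (m + 1), δ i ^ p ^ i ∧
  ξ = normHom p σ n α ^ ((d - 1) / (p : ℤ)) * normHom p σ (n - 1) (δ 0) *
      ∏ i ∈ Finset.Icc 1 m, normHom p σ n (δ i) ^ p ^ (i - 1)

/-- `(a, d)` is a norm pair of length `m`: `a ∈ {-∞,0,…,n}^m` with `a_0 < n`,
`d ∈ U_1`, and some `(α, δ)` represents `(a, d)`. -/
noncomputable def IsNormPair (p n : ℕ) (σ : K ≃ₐ[F] K) (ξ : Kˣ) {m : ℕ}
    (a : Fin m → WithBot ℕ) (d : ℤ) : Prop :=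
  (∀ i, a i ≤ (n : WithBot ℕ)) ∧
  (∀ h0 : 0 < m, a ⟨0, h0⟩ < (n : WithBot ℕ)) ∧
  (p : ℤ) ∣ d - 1 ∧
  ∃ (α : Kˣ) (δ : ℕ → Kˣ), Represents p n σ ξ a d α δ

/-- Strict lexicographic order on norm vectors (with `-∞` smallest). -/
def vecLT {m : ℕ} (a a' : Fin m → WithBot ℕ) : Prop :=
  ∃ k : Fin m, (∀ j : Fin m, j < k → a j = a' j) ∧ a k < a' k

/-- The order `d ≤_m d'` on twists: `d' ∈ U_i → d ∈ U_i` for `1 ≤ i ≤ m`, except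
when `p = 2` and `d, d' ∉ U_2`, in which case `d' ∈ -U_i → d ∈ -U_i` for `2 ≤ i ≤ m`. -/
def twistLE (p m : ℕ) (d d' : ℤ) : Prop :=
  ((p = 2 ∧ ¬ (4 : ℤ) ∣ (d - 1) ∧ ¬ (4 : ℤ) ∣ (d' - 1)) →
    ∀ i : ℕ, 2 ≤ i → i ≤ m → ((2 : ℤ) ^ i ∣ (d' + 1)) → ((2 : ℤ) ^ i ∣ (d + 1))) ∧
  (¬ (p = 2 ∧ ¬ (4 : ℤ) ∣ (d - 1) ∧ ¬ (4 : ℤ) ∣ (d' - 1)) →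
    ∀ i : ℕ, 1 ≤ i → i ≤ m → ((p : ℤ) ^ i ∣ (d' - 1)) → ((p : ℤ) ^ i ∣ (d - 1)))

/-- The order `⪯_m` on norm pairs of length `m`. -/
def pairLE (p : ℕ) {m : ℕ} (a : Fin m → WithBot ℕ) (d : ℤ)
    (a' : Fin m → WithBot ℕ) (d' : ℤ) : Prop :=
  vecLT a a' ∨ (a = a' ∧ twistLE p m d d')

/-- `(a, d)` is a minimal norm pair of length `m`. -/
noncomputable def IsMinimalNormPair (p n : ℕ) (σ : K ≃ₐ[F] K) (ξ : Kˣ) {m : ℕ}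
    (a : Fin m → WithBot ℕ) (d : ℤ) : Prop :=
  IsNormPair p n σ ξ a d ∧
  ∀ (a' : Fin m → WithBot ℕ) (d' : ℤ), IsNormPair p n σ ξ a' d' → pairLE p a d a' d'

/-- `α` is an `m`-exceptional element. -/
noncomputable def IsExceptional (p n : ℕ) (σ : K ≃ₐ[F] K) (ξ : Kˣ) (m : ℕ) (α : Kˣ) : Prop :=
  ∃ (a : Fin m → WithBot ℕ) (d : ℤ) (δ : ℕ → Kˣ),
    IsMinimalNormPair p n σ ξ a d ∧ Represents p n σ ξ a d α δ

/-- The subgroup of `q`-th powers in `K^×`. -/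
def powSub (K : Type*) [Field K] (q : ℕ) : Subgroup Kˣ := (powMonoidHom q : Kˣ →* Kˣ).range

/-- The class of a unit in `J_q := K^×/K^{×q}`. -/
def jcls (q : ℕ) (γ : Kˣ) : Kˣ ⧸ powSub K q := QuotientGroup.mk γ

/-- The action of a field automorphism on `J_q = K^×/K^{×q}`. -/
noncomputable def jmap (q : ℕ) (τ : K ≃ₐ[F] K) : (Kˣ ⧸ powSub K q) →* Kˣ ⧸ powSub K q :=
  QuotientGroup.map _ _ (umap τ) (by
    rintro x ⟨y, rfl⟩
    exact ⟨umap τ y, by simp [powMonoidHom, map_pow]⟩)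

/-- The natural map `J_q → J_{q'}` when `q' ∣ q`. -/
noncomputable def resMap (q q' : ℕ) (h : q' ∣ q) : (Kˣ ⧸ powSub K q) →* Kˣ ⧸ powSub K q' :=
  QuotientGroup.map _ _ (MonoidHom.id Kˣ) (by
    rintro x ⟨y, rfl⟩
    obtain ⟨c, rfl⟩ := h
    exact ⟨y ^ c, by simp [powMonoidHom, ← pow_mul, mul_comm]⟩)

/-- The `R_m[G]`-submodule of `J_q` generated by the classes of the elements of `S`:
the subgroup generated by all `σ^k`-conjugates of classes of elements of `S`. -/
noncomputable def galSpan (q : ℕ) (σ : K ≃ₐ[F] K) (S : Set Kˣ) : Subgroup (Kˣ ⧸ powSub K q) :=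
  Subgroup.closure {x | ∃ γ ∈ S, ∃ k : ℕ, x = jcls q (umap (σ ^ k) γ)}

/-- The subgroup `(σ-1)J_q` of `J_q`. -/
noncomputable def augSub (q : ℕ) (σ : K ≃ₐ[F] K) : Subgroup (Kˣ ⧸ powSub K q) :=
  Subgroup.closure {x | ∃ y : Kˣ ⧸ powSub K q, x = jmap q σ y * y⁻¹}

/-- The cyclic `F_p[G]`-submodule of `J_1 = K^×/K^{×p}` generated by `[γ]_1` is a
free `F_p[G_i]`-module (on the generator `[γ]_1`): `[γ]_1` is fixed by `σ^{p^i}`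
and the conjugates `σ^k [γ]_1`, `k < p^i`, are `F_p`-linearly independent. -/
noncomputable def FreeCyc (p : ℕ) (σ : K ≃ₐ[F] K) (i : ℕ) (γ : Kˣ) : Prop :=
  jcls p (umap (σ ^ p ^ i) γ) = jcls p γ ∧
  ∀ c : Fin (p ^ i) → ZMod p,
    (∏ k : Fin (p ^ i), jcls p (umap (σ ^ (k : ℕ)) γ) ^ (c k).val) = 1 → c = 0

/-- An (indexed) internal direct sum decomposition of a commutative group. -/
def IsDirectSumDecomp {G : Type*} [CommGroup G] {ι : Sort*} (f : ι → Subgroup G) : Prop :=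
  iSupIndep f ∧ (⨆ i, f i) = ⊤

/-- The subgroup `F^×` of `K^×` (units coming from the base field). -/
def Funits (F : Type*) {K : Type*} [Field F] [Field K] [Algebra F K] : Subgroup Kˣ :=
  (Units.map (algebraMap F K : F →* K)).range

/-- The subgroup `F^{×p}` of `K^×`. -/
def FpPow (F : Type*) {K : Type*} [Field F] [Field K] [Algebra F K] (p : ℕ) : Subgroup Kˣ :=
  (Funits F).map (powMonoidHom p)

/-- The subgroup `N_{K_i/F}(K_i^×)` of `K^×`. -/
noncomputable def NormSub (p : ℕ) (σ : K ≃ₐ[F] K) (i : ℕ) : Subgroup Kˣ :=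
  (KiU p σ i).map (normHom p σ i)

/-- The subgroup `N_{K_i/F}(K_i^×)·F^{×p}` of `K^×`. -/
noncomputable def NiF (p : ℕ) (σ : K ≃ₐ[F] K) (i : ℕ) : Subgroup Kˣ :=
  NormSub p σ i ⊔ FpPow F p

/-- The `F_p`-dimension of an (elementary abelian `p`-) commutative group `Q`,
computed as the rank of `F_p ⊗_ℤ Q`. -/
noncomputable def fpdim (p : ℕ) (Q : Type*) [CommGroup Q] : Cardinal :=
  Module.rank (ZMod p) (TensorProduct ℤ (ZMod p) (Additive Q))

/-- The invariant `e_i(K/F)`: for `i < n` the `F_p`-dimension of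
`N_{K_i/F}(K_i^×)F^{×p} / N_{K_{i+1}/F}(K_{i+1}^×)F^{×p}`, and for `i = n` the
`F_p`-dimension of `N_{K/F}(K^×)F^{×p}/F^{×p}`. -/
noncomputable def eKF (p n : ℕ) (σ : K ≃ₐ[F] K) (i : ℕ) : Cardinal :=
  if i < n then
    fpdim p ((NiF p σ i) ⧸ (NiF p σ (i + 1)).subgroupOf (NiF p σ i))
  else
    fpdim p ((NiF p σ n) ⧸ (FpPow F p).subgroupOf (NiF p σ n))

/-- The group ring `R_m[G_i] = (ℤ/p^m)[ℤ/p^i]` (for the cyclic group `G_i` of order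
`p^i`). -/
abbrev CycGR (p m i : ℕ) : Type :=
  MonoidAlgebra (ZMod (p ^ m)) (Multiplicative (ZMod (p ^ i)))

/-- The image of the generator `σ` of `G_i` in the group ring `R_m[G_i]`. -/
noncomputable def gen (p m i : ℕ) : CycGR p m i :=
  MonoidAlgebra.of _ _ (Multiplicative.ofAdd (1 : ZMod (p ^ i)))

/-- Standard basis vector of the free `R_m[G]`-module on generators `e_0, …, e_m`. -/
noncomputable def sing (p n m : ℕ) (j : Fin (m + 1)) (c : CycGR p m n) :
    Fin (m + 1) → CycGR p m n :=
  Pi.single j c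

/-- The relations defining the module `X_{a,d,m}`: on generators `y = e_0` and
`x_i = e_{i+1}` (`0 ≤ i < m`), we impose `(σ - d)·y = Σ_i p^i x_i`, and
`(σ^{p^{a_i}} - 1)·x_i = 0` when `a_i ≠ -∞`, resp. `x_i = 0` when `a_i = -∞`. -/
noncomputable def XRels (p n m : ℕ) (a : Fin m → WithBot ℕ) (d : ℤ) :
    Set (Fin (m + 1) → CycGR p m n) :=
  insert
    (sing p n m 0 (gen p m n - (d : ZMod (p ^ m)) • 1) -
      ∑ i : Fin m, sing p n m i.succ ((p : CycGR p m n) ^ (i : ℕ)))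
    {r | ∃ i : Fin m, r = sing p n m i.succ
      (WithBot.recBotCoe (1 : CycGR p m n) (fun k => gen p m n ^ p ^ k - 1) (a i))}

/-- The `R_m[G]`-module `X_{a,d,m}`. -/
noncomputable abbrev Xadm (p n m : ℕ) (a : Fin m → WithBot ℕ) (d : ℤ) :=
  (Fin (m + 1) → CycGR p m n) ⧸ Submodule.span (CycGR p m n) (XRels p n m a d)

/-- Indecomposability of a module. -/
def IsIndecomposable (R M : Type*) [Ring R] [AddCommGroup M] [Module R M] : Prop :=
  (⊤ : Submodule R M) ≠ ⊥ ∧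
  ∀ S T : Submodule R M, S ⊓ T = ⊥ → S ⊔ T = ⊤ → S = ⊥ ∨ T = ⊥

end MSS

universe u v

namespace MSS

variable {F : Type u} {K : Type v} [Field F] [Field K] [Algebra F K]

theorem umap_mul_apply (σ τ : K ≃ₐ[F] K) (γ : Kˣ) :
    umap (σ * τ) γ = umap σ (umap τ γ) := rfl

theorem mem_KiU {p : ℕ} {σ : K ≃ₐ[F] K} {i : ℕ} {γ : Kˣ} :
    γ ∈ KiU p σ i ↔ umap (σ ^ p ^ i) γ = γ := by
  rw [KiU, MonoidHom.mem_ker, MonoidHom.div_apply, div_eq_one, MonoidHom.id_apply]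

theorem umap_pow_mul_of_fixed {σ : K ≃ₐ[F] K} {γ : Kˣ} {N : ℕ}
    (h : umap (σ ^ N) γ = γ) (q : ℕ) : umap (σ ^ (N * q)) γ = γ := by
  induction q with
  | zero => ext; simp [umap]
  | succ q ih => rw [Nat.mul_succ, pow_add, umap_mul_apply, h, ih]

theorem KiU_mono (p : ℕ) (σ : K ≃ₐ[F] K) {i j : ℕ} (h : i ≤ j) :
    KiU p σ i ≤ KiU p σ j := by
  intro γ hγ
  rw [mem_KiU] at hγ ⊢
  obtain ⟨k, rfl⟩ := Nat.exists_eq_add_of_le h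
  rw [pow_add]
  exact umap_pow_mul_of_fixed hγ _

theorem normHom_apply (p : ℕ) (σ : K ≃ₐ[F] K) (j : ℕ) (γ : Kˣ) :
    normHom p σ j γ = ∏ k ∈ Finset.range (p ^ j), umap (σ ^ k) γ := by
  simp [normHom]

theorem normHom_succ_of_mem {p : ℕ} {σ : K ≃ₐ[F] K} {b : ℕ} {γ : Kˣ}
    (h : γ ∈ KiU p σ b) : normHom p σ (b + 1) γ = normHom p σ b γ ^ p := by
  rw [mem_KiU] at h
  have key (q : ℕ) : ∏ k ∈ Finset.range (p ^ b * q), umap (σ ^ k) γ =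
      (∏ k ∈ Finset.range (p ^ b), umap (σ ^ k) γ) ^ q := by
    induction q with
    | zero => simp
    | succ q ih =>
      rw [Nat.mul_succ, add_comm, Finset.prod_range_add, pow_succ', ← ih]
      congr 1
      refine Finset.prod_congr rfl fun k _ => ?_
      rw [add_comm, pow_add, umap_mul_apply, h]
  rw [normHom_apply, normHom_apply, pow_succ, key]

theorem levelMem_bot {p : ℕ} {σ : K ≃ₐ[F] K} {γ : Kˣ} :
    levelMem p σ ⊥ γ ↔ γ = 1 := Iff.rfl

theorem levelMem_coe {p : ℕ} {σ : K ≃ₐ[F] K} {i : ℕ} {γ : Kˣ} :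
    levelMem p σ (i : WithBot ℕ) γ ↔ γ ∈ KiU p σ i := Iff.rfl

theorem levelMem_mono {p : ℕ} {σ : K ≃ₐ[F] K} {a b : WithBot ℕ} (h : a ≤ b) {γ : Kˣ}
    (hγ : levelMem p σ a γ) : levelMem p σ b γ := by
  cases a with
  | bot =>
    obtain rfl := levelMem_bot.1 hγ
    cases b with
    | bot => exact rfl
    | coe b => exact levelMem_coe.2 (one_mem _)
  | coe a =>
    cases b with
    | bot => simp at h
    | coe b => exact KiU_mono p σ (WithBot.coe_le_coe.1 h) hγ

theorem levelMem_mul {p : ℕ} {σ : K ≃ₐ[F] K} {a : WithBot ℕ} {γ γ' : Kˣ}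
    (h : levelMem p σ a γ) (h' : levelMem p σ a γ') : levelMem p σ a (γ * γ') := by
  cases a with
  | bot => rw [levelMem_bot] at *; simp [h, h']
  | coe a => exact mul_mem h h'

theorem levelMem_zpow {p : ℕ} {σ : K ≃ₐ[F] K} {a : WithBot ℕ} {γ : Kˣ}
    (h : levelMem p σ a γ) (k : ℤ) : levelMem p σ a (γ ^ k) := by
  cases a with
  | bot => rw [levelMem_bot] at *; simp [h]
  | coe a => exact zpow_mem (levelMem_coe.1 h) k

theorem levelMem_pow {p : ℕ} {σ : K ≃ₐ[F] K} {a : WithBot ℕ} {γ : Kˣ}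
    (h : levelMem p σ a γ) (k : ℕ) : levelMem p σ a (γ ^ k) := by
  simpa using levelMem_zpow h k

/-- Multiplying a representing pair by a solution of the homogeneous equations gives
another representing pair. -/
theorem Represents.mul {p n : ℕ} {σ : K ≃ₐ[F] K} {ξ : Kˣ} {m : ℕ}
    {a a' : Fin m → WithBot ℕ} {d : ℤ} {α c : Kˣ} {δ ε : ℕ → Kˣ}
    (h : Represents p n σ ξ a d α δ)
    (hlevel : ∀ i : Fin m, levelMem p σ (a' i) (δ i * ε i))
    (hc : umap σ c = c ^ d * ∏ i ∈ Finset.range (m + 1), ε i ^ p ^ i)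
    (hnorm : normHom p σ n c ^ ((d - 1) / (p : ℤ)) * normHom p σ (n - 1) (ε 0) *
      ∏ i ∈ Finset.Icc 1 m, normHom p σ n (ε i) ^ p ^ (i - 1) = 1) :
    Represents p n σ ξ a' d (α * c) (δ * ε) := by
  obtain ⟨-, h₂, h₃⟩ := h
  refine ⟨hlevel, ?_, ?_⟩
  · simp only [map_mul, Pi.mul_apply, mul_pow, mul_zpow, Finset.prod_mul_distrib, h₂, hc]
    exact mul_mul_mul_comm _ _ _ _
  · rw [← mul_one ξ, ← hnorm, h₃]
    simp only [map_mul, Pi.mul_apply, mul_pow, mul_zpow, Finset.prod_mul_distrib]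
    rw [mul_mul_mul_comm, mul_mul_mul_comm (_ ^ _)]

theorem prod_map_mulSingle {M : Type*} [CommGroup M] (s : Finset ℕ) (f : ℕ → M →* M)
    (i : ℕ) (x : M) :
    ∏ k ∈ s, f k ((Pi.mulSingle i x : ℕ → M) k) = if i ∈ s then f i x else 1 := by
  by_cases hi : i ∈ s
  · rw [if_pos hi, Finset.prod_eq_single_of_mem i hi, Pi.mulSingle_eq_same]
    intro k _ hk
    rw [Pi.mulSingle_eq_of_ne hk, map_one]
  · rw [if_neg hi]
    refine Finset.prod_eq_one fun k hk => ?_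
    rw [Pi.mulSingle_eq_of_ne (ne_of_mem_of_not_mem hk hi), map_one]

theorem prod_pow_mulSingle (p m : ℕ) {i : ℕ} (hi : i ≤ m) (x : Kˣ) :
    ∏ k ∈ Finset.range (m + 1), (Pi.mulSingle i x : ℕ → Kˣ) k ^ p ^ k = x ^ p ^ i := by
  simpa [Nat.lt_succ_iff, hi] using
    prod_map_mulSingle (Finset.range (m + 1)) (fun k => powMonoidHom (p ^ k)) i x

theorem prod_normHom_mulSingle (p n m : ℕ) (σ : K ≃ₐ[F] K) {i : ℕ} (x : Kˣ) :
    ∏ k ∈ Finset.Icc 1 m, normHom p σ n ((Pi.mulSingle i x : ℕ → Kˣ) k) ^ p ^ (k - 1) =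
      if i ∈ Finset.Icc 1 m then normHom p σ n x ^ p ^ (i - 1) else 1 := by
  exact prod_map_mulSingle (Finset.Icc 1 m)
    (fun k => (powMonoidHom (p ^ (k - 1))).comp (normHom p σ n)) i x

theorem not_pairLE_of_lt {p m : ℕ} {a a' : Fin m → WithBot ℕ} {d d' : ℤ} (j : Fin m)
    (heq : ∀ k < j, a' k = a k) (hlt : a' j < a j) : ¬ pairLE p a d a' d' := by
  rintro (⟨k, hk, hkj⟩ | ⟨rfl, -⟩)
  · rcases lt_trichotomy k j with h | rfl | h
    · exact hkj.ne (heq k h).symm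
    · exact hkj.asymm hlt
    · exact hlt.ne (hk j h).symm
  · exact hlt.false

/-- Nontrivial levels of a minimal norm pair strictly increase. -/
theorem IsMinimalNormPair.level_lt {p n m : ℕ} {σ : K ≃ₐ[F] K} {ξ : Kˣ}
    {a : Fin m → WithBot ℕ} {d : ℤ} (hmin : IsMinimalNormPair p n σ ξ a d)
    {i j : Fin m} (hij : i < j) (hj : a j ≠ ⊥) : a i < a j ∨ a i = ⊥ := by
  by_contra! hcon
  obtain ⟨hle, hi⟩ := hcon
  obtain ⟨⟨hn, h0, hd, α, δ, hrep⟩, hm⟩ := hmin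
  have hij' : (i : ℕ) < j := hij
  have hne : (i : ℕ) ≠ j := hij'.ne
  have hji : p ^ ((j : ℕ) - i) * p ^ (i : ℕ) = p ^ (j : ℕ) := by
    rw [← pow_add, Nat.sub_add_cancel hij'.le]
  refine not_pairLE_of_lt j (a' := Function.update a j ⊥) (d' := d)
    (fun k hk => Function.update_of_ne hk.ne _ _) ?_ (hm _ _ ⟨?_, ?_, hd, α * 1,
      δ * (Pi.mulSingle (i : ℕ) (δ j ^ p ^ ((j : ℕ) - i)) * Pi.mulSingle (j : ℕ) (δ j)⁻¹),
      hrep.mul ?_ ?_ ?_⟩)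
  · rw [Function.update_self]
    exact bot_lt_iff_ne_bot.2 hj
  · intro k
    rcases eq_or_ne k j with rfl | hk
    · simp
    · simpa [Function.update_of_ne hk] using hn k
  · intro hpos
    rw [Function.update_of_ne]
    · exact h0 hpos
    · rintro rfl
      simp at hij'
  · intro k
    have hδj : levelMem p σ (a i) (δ j) := levelMem_mono hle (hrep.1 j)
    rcases eq_or_ne k j with rfl | hk
    · rw [Function.update_self, levelMem_bot]
      simp [Pi.mulSingle_eq_of_ne hne.symm]
    · have hk' : (k : ℕ) ≠ j := fun h => hk (Fin.ext h)
      rw [Function.update_of_ne hk]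
      rcases eq_or_ne k i with rfl | hki
      · simp only [Pi.mul_apply, Pi.mulSingle_eq_same, Pi.mulSingle_eq_of_ne hk', mul_one]
        exact levelMem_mul (hrep.1 k) (levelMem_pow hδj _)
      · have hki' : (k : ℕ) ≠ i := fun h => hki (Fin.ext h)
        simpa [Pi.mulSingle_eq_of_ne hk', Pi.mulSingle_eq_of_ne hki'] using hrep.1 k
  · simp only [Pi.mul_apply, mul_pow, Finset.prod_mul_distrib,
      prod_pow_mulSingle p m i.2.le, prod_pow_mulSingle p m j.2.le]
    rw [← pow_mul, hji]
    simp
  · have hjm : (j : ℕ) ∈ Finset.Icc 1 m := Finset.mem_Icc.2 ⟨by omega, j.2.le⟩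
    simp only [Pi.mul_apply, map_mul, mul_pow, Finset.prod_mul_distrib,
      prod_normHom_mulSingle, if_pos hjm]
    rw [Pi.mulSingle_eq_of_ne (i := (j : ℕ)) (i' := 0) (by omega)]
    rcases Nat.eq_zero_or_pos (i : ℕ) with hi0 | hi0
    · have h0m : (0 : ℕ) ∉ Finset.Icc 1 m := by simp
      obtain ⟨k, hk⟩ := WithBot.ne_bot_iff_exists.1 hi
      have hkn : k < n := by
        have := h0 i.pos
        rw [show (⟨0, i.pos⟩ : Fin m) = i from Fin.ext hi0.symm, ← hk] at this
        exact WithBot.coe_lt_coe.1 this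
      obtain ⟨b, rfl⟩ : ∃ b, n = b + 1 := ⟨n - 1, by omega⟩
      have hδj : δ j ∈ KiU p σ b := by
        refine KiU_mono p σ (Nat.lt_succ_iff.1 hkn) (levelMem_coe.1 ?_)
        exact levelMem_mono (hle.trans hk.ge) (hrep.1 j)
      rw [hi0, if_neg h0m, Pi.mulSingle_eq_same, map_inv, normHom_succ_of_mem hδj,
        Nat.add_sub_cancel, inv_pow, ← pow_mul, mul_pow_sub_one (by omega)]
      simp
    · have him : (i : ℕ) ∈ Finset.Icc 1 m := Finset.mem_Icc.2 ⟨hi0, i.2.le⟩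
      have hji' : p ^ ((j : ℕ) - i) * p ^ ((i : ℕ) - 1) = p ^ ((j : ℕ) - 1) := by
        rw [← pow_add]
        congr 1
        omega
      rw [if_pos him, Pi.mulSingle_eq_of_ne (by omega), map_pow, ← pow_mul, hji']
      simp

theorem IsMinimalNormPair.level_ne_zero {n m : ℕ} {σ : K ≃ₐ[F] K} {ξ : Kˣ}
    {a : Fin m → WithBot ℕ} {d : ℤ} (hmin : IsMinimalNormPair 2 n σ ξ a d)
    (hd : ¬ (4 : ℤ) ∣ d - 1) {i : Fin m} (hi : 1 ≤ (i : ℕ)) : a i ≠ (0 : ℕ) := by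
  intro hai
  obtain ⟨⟨hn, h0, hd2, α, δ, hrep⟩, hm⟩ := hmin
  obtain ⟨w, hw⟩ : ∃ w, d = 4 * w + 3 := ⟨(d - 3) / 4, by omega⟩
  have hdiv : (d - 1) / ((2 : ℕ) : ℤ) = 2 * w + 1 := by push_cast; omega
  have hδi : levelMem 2 σ ((0 : ℕ) : WithBot ℕ) (δ i) := hai ▸ hrep.1 i
  have hfix : umap σ (δ i) = δ i := by
    have := mem_KiU.1 (levelMem_coe.1 hδi)
    rwa [pow_zero, pow_one] at this
  obtain ⟨e, he⟩ : ∃ e, (i : ℕ) = e + 1 := ⟨i - 1, by omega⟩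
  have hne : (i : ℕ) ≠ i + 1 := by omega
  let a' : Fin m → WithBot ℕ := fun k =>
    if (k : ℕ) = i then ⊥ else if (k : ℕ) = i + 1 then max (a k) (0 : ℕ) else a k
  refine not_pairLE_of_lt i (a' := a') (d' := d) ?_ ?_ (hm _ _ ⟨?_, ?_, hd2,
      α * δ i ^ 2 ^ e,
      δ * (Pi.mulSingle (i : ℕ) (δ i)⁻¹ * Pi.mulSingle ((i : ℕ) + 1) (δ i ^ (-w))),
      hrep.mul ?_ ?_ ?_⟩)
  · intro k hk
    have hk' : (k : ℕ) < i := hk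
    simp only [a']
    rw [if_neg (by omega), if_neg (by omega)]
  · simp [a', hai]
  · intro k
    simp only [a']
    split_ifs
    · exact bot_le
    · exact max_le (hn k) (WithBot.coe_le_coe.2 (Nat.zero_le n))
    · exact hn k
  · intro hpos
    simp only [a']
    rw [if_neg (by omega), if_neg (by omega)]
    exact h0 hpos
  · intro k
    simp only [a', Pi.mul_apply]
    split_ifs with h₁ h₂
    · rw [h₁, levelMem_bot, Pi.mulSingle_eq_same, Pi.mulSingle_eq_of_ne hne]
      simp
    · rw [Pi.mulSingle_eq_of_ne h₁, h₂, Pi.mulSingle_eq_same, one_mul, ← h₂]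
      exact levelMem_mul (levelMem_mono (le_max_left _ _) (hrep.1 k))
        (levelMem_mono (le_max_right _ _) (levelMem_zpow hδi _))
    · rw [Pi.mulSingle_eq_of_ne h₁, Pi.mulSingle_eq_of_ne h₂]
      simpa using hrep.1 k
  · simp only [Pi.mul_apply, mul_pow, Finset.prod_mul_distrib,
      prod_pow_mulSingle 2 m i.2.le, prod_pow_mulSingle 2 m (Nat.succ_le_of_lt i.2), map_pow, hfix]
    generalize δ i = x
    rw [he, hw, Nat.succ_eq_add_one]
    simp only [← zpow_natCast, ← zpow_mul, ← zpow_add, inv_zpow']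
    congr 1
    push_cast
    ring
  · have him : (i : ℕ) ∈ Finset.Icc 1 m := Finset.mem_Icc.2 ⟨hi, i.2.le⟩
    have him' : (i : ℕ) + 1 ∈ Finset.Icc 1 m := Finset.mem_Icc.2 ⟨by omega, i.2⟩
    simp only [Pi.mul_apply, map_mul, mul_pow, Finset.prod_mul_distrib,
      prod_normHom_mulSingle, if_pos him, if_pos him']
    rw [Pi.mulSingle_eq_of_ne (by omega), Pi.mulSingle_eq_of_ne (by omega), hdiv]
    simp only [map_pow, map_inv, map_zpow, map_one, mul_one, Nat.add_sub_cancel]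
    generalize normHom 2 σ n (δ i) = x
    rw [he, Nat.add_sub_cancel]
    simp only [← zpow_natCast, ← zpow_mul, ← zpow_add, inv_zpow']
    rw [← zpow_zero x]
    congr 1
    push_cast
    ring

end MSS

/-- **Proposition (basic norm pair inequalities).**  Let `(a, d)` be a minimal
norm pair of length `m`.  Then (1) if `0 ≤ i < j < m` with `a_i ≠ -∞ ≠ a_j`,
then `a_i < a_j`; (2) if `p = 2`, `m ≥ 2`, and `d ∉ U_2`, then `a_i ≠ 0` for
every `1 ≤ i < m`. -/
theorem statement_11 {F : Type u} {K : Type v} [Field F] [Field K] [Algebra F K]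
    [IsGalois F K] [FiniteDimensional F K]
    (p n m : ℕ) (hp : p.Prime) (hn : 0 < n) (hm : 0 < m)
    (σ : K ≃ₐ[F] K) (horder : orderOf σ = p ^ n)
    (hgen : ∀ τ : K ≃ₐ[F] K, τ ∈ Subgroup.zpowers σ)
    (ξ : Kˣ) (hξ : IsPrimitiveRoot (ξ : K) p)
    (hξF : (ξ : K) ∈ Set.range (algebraMap F K))
    (hspecial : p = 2 → n = 1 → ∃ γ : Kˣ, MSS.normHom p σ n γ = -1)
    (a : Fin m → WithBot ℕ) (d : ℤ)
    (hmin : MSS.IsMinimalNormPair p n σ ξ a d) :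
    (∀ i j : Fin m, i < j → a i ≠ ⊥ → a j ≠ ⊥ → a i < a j) ∧
    (p = 2 → 2 ≤ m → ¬ ((4 : ℤ) ∣ d - 1) →
      ∀ i : Fin m, 1 ≤ (i : ℕ) → a i ≠ (0 : ℕ)) := by
  refine ⟨fun i j hij hi hj => (hmin.level_lt hij hj).resolve_right hi, ?_⟩
  rintro rfl - hd i hi
  exact hmin.level_ne_zero hd hi
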